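/- arXiv:2105.11984 — 2 statements merged into one kernel-verified Lean document; each statement's English description precedes it below -/
import Mathlib

section
/- Let C_f > 0, L > 0, and let f₀ : ℝ × ℝ → ℝ be differentiable, jointly convex with strict convexity parameter C_f in the second variable, and such that |∂ᵤf₀(x',u) − ∂ᵤf₀(x,u)| ≤ L|x' − x| for all x, x', u ∈ ℝ. For each (x,a) ∈ ℝ², let û(x,a) denote the unique minimizer over u ∈ ℝ of u ↦ a·u + f₀(x,u). Then for all (x,a), (x',a') ∈ ℝ², one has |û(x',a') − û(x,a)| ≤ (2C_f)⁻¹ (L|x' − x| + |a' − a|). -/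
/-- First-order optimality condition in the second variable, for a linear perturbation. -/
theorem add_fderiv_snd_eq_zero_of_forall_le {f : ℝ × ℝ → ℝ} {x a u : ℝ}
    (hf : DifferentiableAt ℝ f (x, u)) (hu : ∀ v, a * u + f (x, u) ≤ a * v + f (x, v)) :
    a + fderiv ℝ f (x, u) (0, 1) = 0 := by
  have hpath : HasDerivAt (fun v : ℝ => (x, v)) ((0 : ℝ), (1 : ℝ)) u :=
    (hasDerivAt_const u x).prodMk (hasDerivAt_id u)
  have hcomp : HasDerivAt (fun v => f (x, v)) (fderiv ℝ f (x, u) (0, 1)) u :=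
    hf.hasFDerivAt.comp_hasDerivAt u hpath
  have hsum : HasDerivAt (fun v => a * v + f (x, v)) (a + fderiv ℝ f (x, u) (0, 1)) u := by
    simpa using ((hasDerivAt_id u).const_mul a).fun_add hcomp
  have hlocal : IsLocalMin (fun v => a * v + f (x, v)) u := Filter.Eventually.of_forall hu
  exact hlocal.hasDerivAt_eq_zero hsum

/-- Let `f₀ : ℝ × ℝ → ℝ` be differentiable, jointly convex with strict
convexity parameter `C_f` in the second variable, with `∂ᵤf₀` `L`-Lipschitz in `x`.
For each `(x,a)`, let `û x a` be the (unique) minimizer over `u` of `u ↦ a*u + f₀(x,u)`.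
Then `|û x' a' - û x a| ≤ (2 C_f)⁻¹ (L |x' - x| + |a' - a|)`.
Here `∂ₓf₀(x,u) = fderiv ℝ f₀ (x,u) (1,0)` and `∂ᵤf₀(x,u) = fderiv ℝ f₀ (x,u) (0,1)`. -/
theorem minimizer_lipschitz
    (Cf L : ℝ) (hCf : 0 < Cf) (hL : 0 < L)
    (f₀ : ℝ × ℝ → ℝ) (hdiff : Differentiable ℝ f₀)
    (hconv : ∀ x x' u u' : ℝ,
      f₀ (x', u') - f₀ (x, u) - fderiv ℝ f₀ (x, u) (1, 0) * (x' - x)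
          - fderiv ℝ f₀ (x, u) (0, 1) * (u' - u)
        ≥ Cf * (u' - u) ^ 2)
    (hlipx : ∀ x x' u : ℝ,
      |fderiv ℝ f₀ (x', u) (0, 1) - fderiv ℝ f₀ (x, u) (0, 1)| ≤ L * |x' - x|)
    (uhat : ℝ → ℝ → ℝ)
    (hmin : ∀ x a v : ℝ, a * uhat x a + f₀ (x, uhat x a) ≤ a * v + f₀ (x, v))
    (x a x' a' : ℝ) :
    |uhat x' a' - uhat x a| ≤ (2 * Cf)⁻¹ * (L * |x' - x| + |a' - a|) := by
  have hopt := add_fderiv_snd_eq_zero_of_forall_le (hdiff (x, uhat x a)) (hmin x a)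
  have hopt' := add_fderiv_snd_eq_zero_of_forall_le (hdiff (x', uhat x' a')) (hmin x' a')
  have hforward := hconv x' x' (uhat x a) (uhat x' a')
  have hbackward := hconv x' x' (uhat x' a') (uhat x a)
  have hlip := hlipx x x' (uhat x a)
  set p := fderiv ℝ f₀ (x', uhat x' a') (0, 1)
  set q := fderiv ℝ f₀ (x, uhat x a) (0, 1)
  set r := fderiv ℝ f₀ (x', uhat x a) (0, 1)
  set d := uhat x' a' - uhat x a
  have hmono : 2 * Cf * d ^ 2 ≤ (p - r) * d := by linarith
  have hgap : |p - r| ≤ L * |x' - x| + |a' - a| := by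
    have hsplit : p - r = -(r - q) - (a' - a) := by linarith
    calc |p - r| ≤ |-(r - q)| + |a' - a| := hsplit ▸ abs_sub _ _
      _ ≤ L * |x' - x| + |a' - a| := by rw [abs_neg]; gcongr
  have hbound : 2 * Cf * |d| ≤ |p - r| := by
    rcases (abs_nonneg d).eq_or_lt with hzero | hpos
    · simp [← hzero]
    · refine le_of_mul_le_mul_right ?_ hpos
      calc 2 * Cf * |d| * |d| = 2 * Cf * d ^ 2 := by rw [← sq_abs]; ring
        _ ≤ (p - r) * d := hmono
        _ ≤ |p - r| * |d| := by rw [← abs_mul]; exact le_abs_self _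
  rw [inv_mul_eq_div, le_div_iff₀ (by positivity), mul_comm]
  exact hbound.trans hgap
end

section
/- Fix T > 0, L > 0, B_u > 0 with B_u ≤ L, and C_f > 0. For φ ∈ {b, σ, σ̃}, let φ(t,x,u,m) = φ₀(t,m) + φ₁(t)x + φ₂(t)u, where φ₁, φ₂ : [0,T] → ℝ are bounded by L, |σ₂(t)| ≤ B_u and |σ̃₂(t)| ≤ B_u for all t, and φ₀ : [0,T] × P₂(ℝ) → ℝ, with P₂(ℝ) the set of Borel probability measures on ℝ with finite second moment. Let f(t,x,u,m) = f₀(t,x,u) + f₁(t,x,m), where f₁ : [0,T] × ℝ × P₂(ℝ) → ℝ, and where for each t the function f₀(t,·,·) : ℝ × ℝ → ℝ is differentiable, jointly convex with strict convexity parameter C_f in the second variable, and its gradient (∂ₓf₀, ∂ᵤf₀)(t,·,·) is L-Lipschitz continuous uniformly in t. Define the generalized Hamiltonian H(t,x,p,q,q̃,u,m) = b(t,x,u,m)p + σ(t,x,u,m)q + σ̃(t,x,u,m)q̃ + f(t,x,u,m). Then for every t ∈ [0,T], m ∈ P₂(ℝ), and (x,p,q,q̃) ∈ ℝ⁴, there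 exists a unique û(t,x,p,q,q̃) ∈ ℝ minimizing u ↦ H(t,x,p,q,q̃,u,m) over ℝ; this minimizer does not depend on m; and for all t ∈ [0,T] and all (x,p,q,q̃), (x',p',q',q̃') ∈ ℝ⁴, |û(t,x',p',q',q̃') − û(t,x,p,q,q̃)| ≤ L(2C_f)⁻¹(|x' − x| + |p' − p|) + B_u(2C_f)⁻¹(|q' − q| + |q̃' − q̃|). -/
open MeasureTheory

/-- `P₂(ℝ)`: Borel probability measures on `ℝ` with finite second moment. -/
abbrev P2 : Type :=
  {μ : ProbabilityMeasure ℝ // Integrable (fun y : ℝ => y ^ 2) (μ : Measure ℝ)}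

/-- A function lying above its tangent lines with quadratic gap has a strongly monotone slope. -/
theorem slope_strongly_monotone {g G : ℝ → ℝ} {c : ℝ}
    (hg : ∀ u v, c * (v - u) ^ 2 ≤ g v - g u - G u * (v - u)) (u v : ℝ) :
    2 * c * (v - u) ^ 2 ≤ (G v - G u) * (v - u) := by
  linarith [hg u v, hg v u]

/-- A continuous strongly monotone function on the real line is surjective. -/
theorem surjective_of_strongly_monotone {G : ℝ → ℝ} {c : ℝ} (hc : 0 < c) (hG : Continuous G)
    (hmono : ∀ u v, c * (v - u) ^ 2 ≤ (G v - G u) * (v - u)) : Function.Surjective G := by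
  intro y
  have growth : ∀ u v, u ≤ v → c * (v - u) ≤ G v - G u := by
    intro u v huv
    rcases huv.eq_or_lt with rfl | hlt
    · simp
    · exact le_of_mul_le_mul_right (by linarith [hmono u v]) (sub_pos.mpr hlt)
  set r := |y - G 0| / c
  have hr : 0 ≤ r := by positivity
  have hcr : c * r = |y - G 0| := mul_div_cancel₀ _ hc.ne'
  refine mem_range_of_exists_le_of_exists_ge hG ⟨-r, ?_⟩ ⟨r, ?_⟩
  · linarith [growth (-r) 0 (by linarith), neg_abs_le (y - G 0)]
  · linarith [growth 0 r hr, le_abs_self (y - G 0)]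

/-- Zeros of strongly monotone functions depend on the function in a Lipschitz way. -/
theorem abs_sub_le_of_strongly_monotone {G : ℝ → ℝ} {c u v d : ℝ} (hc : 0 < c)
    (hmono : c * (v - u) ^ 2 ≤ (G v - G u) * (v - u)) (hd : |G v - G u| ≤ d) :
    |v - u| ≤ c⁻¹ * d := by
  rw [inv_mul_eq_div, le_div_iff₀ hc]
  rcases (abs_nonneg (v - u)).eq_or_lt with h0 | hpos
  · rw [← h0, zero_mul]
    exact (abs_nonneg _).trans hd
  · refine le_of_mul_le_mul_right ?_ hpos
    calc |v - u| * c * |v - u| = c * (v - u) ^ 2 := by rw [← sq_abs (v - u)]; ring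
      _ ≤ (G v - G u) * (v - u) := hmono
      _ ≤ |G v - G u| * |v - u| := (le_abs_self _).trans_eq (abs_mul _ _)
      _ ≤ d * |v - u| := by gcongr

/-- **Lemma 3.1 of the paper.** With affine coefficients
`φ(t,x,u,m) = φ₀(t,m) + φ₁(t) x + φ₂(t) u` for `φ = b, σ, σ̃` (with `φ₁, φ₂` bounded by `L`
and `σ₂, σ̃₂` bounded by `B_u ≤ L` on `[0,T]`), separable cost
`f(t,x,u,m) = f₀(t,x,u) + f₁(t,x,m)` with `f₀(t,·,·)` differentiable, jointly convex with
strict convexity parameter `C_f` in `u`, and `L`-Lipschitz gradient, the generalized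
Hamiltonian `H(t,x,p,q,q̃,u,m) = b p + σ q + σ̃ q̃ + f` admits, for every `t ∈ [0,T]`,
`m ∈ P₂(ℝ)` and `(x,p,q,q̃) ∈ ℝ⁴`, a unique minimizer in `u`; this minimizer `û(t,x,p,q,q̃)`
does not depend on `m`, and it is `L(2C_f)⁻¹`-Lipschitz in `(x,p)` and `B_u(2C_f)⁻¹`-Lipschitz
in `(q,q̃)`, uniformly in `t`. -/
theorem hamiltonian_unique_minimizer_lipschitz
    (T L Bu Cf : ℝ) (hT : 0 < T) (hL : 0 < L) (hBu : 0 < Bu) (hBuL : Bu ≤ L) (hCf : 0 < Cf)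
    (b₀ σ₀ σt₀ : ℝ → P2 → ℝ)
    (b₁ b₂ σ₁ σ₂ σt₁ σt₂ : ℝ → ℝ)
    (hbnd : ∀ t ∈ Set.Icc (0 : ℝ) T,
      |b₁ t| ≤ L ∧ |b₂ t| ≤ L ∧ |σ₁ t| ≤ L ∧ |σ₂ t| ≤ L ∧ |σt₁ t| ≤ L ∧ |σt₂ t| ≤ L)
    (hσ₂Bu : ∀ t ∈ Set.Icc (0 : ℝ) T, |σ₂ t| ≤ Bu)
    (hσt₂Bu : ∀ t ∈ Set.Icc (0 : ℝ) T, |σt₂ t| ≤ Bu)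
    (f₀ : ℝ → ℝ × ℝ → ℝ) (f₁ : ℝ → ℝ → P2 → ℝ)
    (hdiff : ∀ t ∈ Set.Icc (0 : ℝ) T, Differentiable ℝ (f₀ t))
    (hconv : ∀ t ∈ Set.Icc (0 : ℝ) T, ∀ x x' u u' : ℝ,
      f₀ t (x', u') - f₀ t (x, u) - fderiv ℝ (f₀ t) (x, u) (1, 0) * (x' - x)
          - fderiv ℝ (f₀ t) (x, u) (0, 1) * (u' - u)
        ≥ Cf * (u' - u) ^ 2)
    (hlip : ∀ t ∈ Set.Icc (0 : ℝ) T, ∀ w w' : ℝ × ℝ,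
      ‖((fderiv ℝ (f₀ t) w' (1, 0) - fderiv ℝ (f₀ t) w (1, 0),
          fderiv ℝ (f₀ t) w' (0, 1) - fderiv ℝ (f₀ t) w (0, 1)) : ℝ × ℝ)‖ ≤ L * ‖w' - w‖) :
    ∃ uhat : ℝ → ℝ → ℝ → ℝ → ℝ → ℝ,
      (∀ t ∈ Set.Icc (0 : ℝ) T, ∀ (m : P2) (x p q qt : ℝ),
        (∀ v : ℝ,
          (b₀ t m + b₁ t * x + b₂ t * uhat t x p q qt) * p
              + (σ₀ t m + σ₁ t * x + σ₂ t * uhat t x p q qt) * q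
              + (σt₀ t m + σt₁ t * x + σt₂ t * uhat t x p q qt) * qt
              + (f₀ t (x, uhat t x p q qt) + f₁ t x m)
            ≤ (b₀ t m + b₁ t * x + b₂ t * v) * p
              + (σ₀ t m + σ₁ t * x + σ₂ t * v) * q
              + (σt₀ t m + σt₁ t * x + σt₂ t * v) * qt
              + (f₀ t (x, v) + f₁ t x m)) ∧
        (∀ u : ℝ,
          (∀ v : ℝ,
            (b₀ t m + b₁ t * x + b₂ t * u) * p
                + (σ₀ t m + σ₁ t * x + σ₂ t * u) * q
                + (σt₀ t m + σt₁ t * x + σt₂ t * u) * qt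
                + (f₀ t (x, u) + f₁ t x m)
              ≤ (b₀ t m + b₁ t * x + b₂ t * v) * p
                + (σ₀ t m + σ₁ t * x + σ₂ t * v) * q
                + (σt₀ t m + σt₁ t * x + σt₂ t * v) * qt
                + (f₀ t (x, v) + f₁ t x m)) →
          u = uhat t x p q qt)) ∧
      (∀ t ∈ Set.Icc (0 : ℝ) T, ∀ x p q qt x' p' q' qt' : ℝ,
        |uhat t x' p' q' qt' - uhat t x p q qt|
          ≤ L * (2 * Cf)⁻¹ * (|x' - x| + |p' - p|)
            + Bu * (2 * Cf)⁻¹ * (|q' - q| + |qt' - qt|)) := by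
  set G : ℝ → ℝ → ℝ → ℝ := fun t x u => fderiv ℝ (f₀ t) (x, u) (0, 1)
  have hgap : ∀ t ∈ Set.Icc (0 : ℝ) T, ∀ x u v : ℝ,
      Cf * (v - u) ^ 2 ≤ f₀ t (x, v) - f₀ t (x, u) - G t x u * (v - u) := by
    intro t ht x u v
    simpa using hconv t ht x x u v
  have hmono : ∀ t ∈ Set.Icc (0 : ℝ) T, ∀ x u v : ℝ,
      2 * Cf * (v - u) ^ 2 ≤ (G t x v - G t x u) * (v - u) := fun t ht x =>
    slope_strongly_monotone (hgap t ht x)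
  have hGlip : ∀ t ∈ Set.Icc (0 : ℝ) T, ∀ x x' u u' : ℝ,
      |G t x' u' - G t x u| ≤ L * max |x' - x| |u' - u| := fun t ht x x' u u' =>
    (norm_snd_le _).trans (hlip t ht (x, u) (x', u'))
  have hGcont : ∀ t ∈ Set.Icc (0 : ℝ) T, ∀ x : ℝ, Continuous (G t x) := by
    intro t ht x
    refine (LipschitzWith.of_dist_le_mul (K := L.toNNReal) fun v u => ?_).continuous
    simpa [Real.dist_eq, hL.le] using hGlip t ht x x u v
  have hroot : ∀ t x p q qt : ℝ, ∃ u : ℝ, t ∈ Set.Icc (0 : ℝ) T →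
      G t x u = -(b₂ t * p + σ₂ t * q + σt₂ t * qt) := by
    intro t x p q qt
    by_cases ht : t ∈ Set.Icc (0 : ℝ) T
    · obtain ⟨u, hu⟩ := surjective_of_strongly_monotone (by positivity) (hGcont t ht x)
        (hmono t ht x) (-(b₂ t * p + σ₂ t * q + σt₂ t * qt))
      exact ⟨u, fun _ => hu⟩
    · exact ⟨0, fun h => absurd h ht⟩
  choose uhat huhat using hroot
  refine ⟨uhat, fun t ht m x p q qt => ?_, fun t ht x p q qt x' p' q' qt' => ?_⟩
  · have hmin := hgap t ht x (uhat t x p q qt)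
    rw [huhat t x p q qt ht] at hmin
    refine ⟨fun v => ?_, fun u hu => ?_⟩
    · linarith [hmin v, mul_nonneg hCf.le (sq_nonneg (v - uhat t x p q qt))]
    · have hle : Cf * (u - uhat t x p q qt) ^ 2 ≤ 0 := by
        linarith [hmin u, hu (uhat t x p q qt)]
      have hsq : (u - uhat t x p q qt) ^ 2 = 0 :=
        le_antisymm (nonpos_of_mul_nonpos_right hle hCf) (sq_nonneg _)
      exact sub_eq_zero.mp (pow_eq_zero_iff two_ne_zero |>.mp hsq)
  · have hslope : |G t x' (uhat t x' p' q' qt') - G t x' (uhat t x p q qt)|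
        ≤ L * (|x' - x| + |p' - p|) + Bu * (|q' - q| + |qt' - qt|) := by
      have hx : |G t x (uhat t x p q qt) - G t x' (uhat t x p q qt)| ≤ L * |x' - x| := by
        simpa [abs_sub_comm x x'] using hGlip t ht x' x (uhat t x p q qt) (uhat t x p q qt)
      have hp : |b₂ t * (p' - p)| ≤ L * |p' - p| := by
        rw [abs_mul]; gcongr; exact (hbnd t ht).2.1
      have hq : |σ₂ t * (q' - q)| ≤ Bu * |q' - q| := by
        rw [abs_mul]; gcongr; exact hσ₂Bu t ht
      have hqt : |σt₂ t * (qt' - qt)| ≤ Bu * |qt' - qt| := by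
        rw [abs_mul]; gcongr; exact hσt₂Bu t ht
      have h := huhat t x p q qt ht
      have h' := huhat t x' p' q' qt' ht
      rw [abs_le] at hx hp hq hqt ⊢
      constructor <;> linarith
    refine (abs_sub_le_of_strongly_monotone (by positivity) (hmono t ht x' _ _) hslope).trans_eq ?_
    ring
end
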